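/- arXiv:1610.06654 — 4 statements merged into one kernel-verified Lean document; each statement's English description precedes it below -/
import Mathlib

section
/- For every integer k ≥ 1, the matrix C(k) of order 2^k defined recursively by C(1) = [[0,−1],[1,0]] and C(k) = [[C(k−1), C(k−1)−I],[C(k−1)+I, −C(k−1)]] (block form with blocks of order 2^{k−1}) is a skew-symmetric conference matrix; that is, all diagonal entries of C(k) are 0, all off-diagonal entries are ±1, C(k)ᵀ = −C(k), and C(k)·C(k)ᵀ = (2^k−1)·I. -/
open Matrix Polynomial

/-- The recursively defined skew-symmetric conference matrix of order `2 ^ k`: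
`Cmat 1 = !![0, -1; 1, 0]` and
`Cmat (k+1) = [[Cmat k, Cmat k - I], [Cmat k + I, -(Cmat k)]]` in block form. -/
def Cmat : (k : ℕ) → Matrix (Fin (2 ^ k)) (Fin (2 ^ k)) ℝ
  | 0 => 0
  | (k + 1) =>
      Matrix.reindex
        (finSumFinEquiv.trans (finCongr (by ring : 2 ^ k + 2 ^ k = 2 ^ (k + 1))))
        (finSumFinEquiv.trans (finCongr (by ring : 2 ^ k + 2 ^ k = 2 ^ (k + 1))))
        (Matrix.fromBlocks (Cmat k) (Cmat k - 1) (Cmat k + 1) (-(Cmat k)))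

/-- Passing from `C` to the block matrix `[[C, C - 1], [C + 1, -C]]` preserves the properties of a
skew-symmetric conference matrix and doubles the order `c`. -/
theorem fromBlocks_skew_conference {n : Type*} [Fintype n] [DecidableEq n] {C : Matrix n n ℝ}
    {c : ℝ} (hdiag : ∀ i, C i i = 0) (hoff : ∀ i j, i ≠ j → C i j = 1 ∨ C i j = -1)
    (hskew : Cᵀ = -C) (hmul : C * Cᵀ = (c - 1) • 1) :
    (∀ i, fromBlocks C (C - 1) (C + 1) (-C) i i = 0) ∧
    (∀ i j, i ≠ j → fromBlocks C (C - 1) (C + 1) (-C) i j = 1 ∨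
      fromBlocks C (C - 1) (C + 1) (-C) i j = -1) ∧
    (fromBlocks C (C - 1) (C + 1) (-C))ᵀ = -fromBlocks C (C - 1) (C + 1) (-C) ∧
    fromBlocks C (C - 1) (C + 1) (-C) * (fromBlocks C (C - 1) (C + 1) (-C))ᵀ =
      (2 * c - 1) • 1 := by
  have hsq : C * C = (1 - c) • 1 := by
    rw [hskew, mul_neg, neg_eq_iff_eq_neg, ← neg_smul, neg_sub] at hmul
    exact hmul
  have hskew' : (fromBlocks C (C - 1) (C + 1) (-C))ᵀ = -fromBlocks C (C - 1) (C + 1) (-C) := by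
    rw [fromBlocks_transpose, fromBlocks_neg, transpose_add, transpose_sub, transpose_neg, hskew,
      transpose_one]
    congr 1 <;> abel
  refine ⟨?_, ?_, hskew', ?_⟩
  · rintro (i | i) <;> simp [hdiag]
  · rintro (i | i) (j | j) hij
    · exact hoff i j fun h => hij (congrArg Sum.inl h)
    · by_cases h : i = j
      · subst h; simp [hdiag]
      · simpa [one_apply_ne h] using hoff i j h
    · by_cases h : i = j
      · subst h; simp [hdiag]
      · simpa [one_apply_ne h] using hoff i j h
    · simpa [neg_eq_iff_eq_neg, or_comm] using hoff i j fun h => hij (congrArg Sum.inr h)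
  · rw [hskew', mul_neg, fromBlocks_multiply, fromBlocks_neg, ← fromBlocks_one, fromBlocks_smul]
    congr 1 <;> simp only [mul_add, add_mul, mul_sub, sub_mul, mul_neg, neg_mul, mul_one, one_mul,
      hsq] <;> module

/-- The conference matrix properties of `Cmat k`, including the degenerate order `1`. -/
theorem Cmat_skew_conference (k : ℕ) :
    (∀ i, Cmat k i i = 0) ∧
    (∀ i j, i ≠ j → Cmat k i j = 1 ∨ Cmat k i j = -1) ∧
    (Cmat k)ᵀ = -(Cmat k) ∧
    Cmat k * (Cmat k)ᵀ = ((2 ^ k : ℝ) - 1) • 1 := by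
  induction k with
  | zero =>
    refine ⟨fun i => rfl, fun i j hij => ?_, by simp [Cmat], by simp [Cmat]⟩
    exact absurd (Fin.ext (by omega)) hij
  | succ k ih =>
    obtain ⟨hdiag, hoff, hskew, hmul⟩ := ih
    obtain ⟨hdiag', hoff', hskew', hmul'⟩ := fromBlocks_skew_conference hdiag hoff hskew hmul
    rw [Cmat]
    refine ⟨fun i => hdiag' _, fun i j hij => hoff' _ _ fun h => hij (Equiv.injective _ h), ?_, ?_⟩
    · rw [transpose_reindex, hskew']
      rfl
    · rw [transpose_reindex, reindex_apply, reindex_apply, submatrix_mul_equiv, hmul',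
        submatrix_smul, Pi.smul_apply, Pi.smul_apply, submatrix_one_equiv,
        pow_succ' (2 : ℝ)]

theorem stmt_0 (k : ℕ) (hk : 1 ≤ k) :
    (∀ i, Cmat k i i = 0) ∧
    (∀ i j, i ≠ j → Cmat k i j = 1 ∨ Cmat k i j = -1) ∧
    (Cmat k)ᵀ = -(Cmat k) ∧
    Cmat k * (Cmat k)ᵀ = ((2 ^ k : ℝ) - 1) • 1 :=
  Cmat_skew_conference k
end

section
/- Let k ≥ 1 be an integer and let C(k) be the recursively defined skew-symmetric conference matrix of order 2^k. Then for every depth d ∈ {1,…,k−1} and every q ∈ {1,…,2^d}, the principal submatrix of C(k) whose rows and columns are indexed by S_{d,q} = {(q−1)·2^{k−d}+1, …, q·2^{k−d}} equals either C(k−d) or −C(k−d). -/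
open Matrix

theorem Cmat_succ_submatrix_left {ι : Type*} (n : ℕ) (f : ι → Fin (2 ^ n))
    (e : ι → Fin (2 ^ (n + 1))) (h : ∀ t, (e t : ℕ) = f t) :
    (Cmat (n + 1)).submatrix e e = (Cmat n).submatrix f f := by
  have he : ∀ t, (finSumFinEquiv.trans
      (finCongr (by ring : 2 ^ n + 2 ^ n = 2 ^ (n + 1)))).symm (e t) = Sum.inl (f t) := by
    intro t
    rw [Equiv.symm_apply_eq]
    ext
    simp [h]
  ext i j
  rw [submatrix_apply, Cmat, reindex_apply, submatrix_apply, he, he, fromBlocks_apply₁₁,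
    submatrix_apply]

theorem Cmat_succ_submatrix_right {ι : Type*} (n : ℕ) (f : ι → Fin (2 ^ n))
    (e : ι → Fin (2 ^ (n + 1))) (h : ∀ t, (e t : ℕ) = 2 ^ n + f t) :
    (Cmat (n + 1)).submatrix e e = -(Cmat n).submatrix f f := by
  have he : ∀ t, (finSumFinEquiv.trans
      (finCongr (by ring : 2 ^ n + 2 ^ n = 2 ^ (n + 1)))).symm (e t) = Sum.inr (f t) := by
    intro t
    rw [Equiv.symm_apply_eq]
    ext
    simp [h, add_comm]
  ext i j
  rw [submatrix_apply, Cmat, reindex_apply, submatrix_apply, he, he, fromBlocks_apply₂₂,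
    neg_apply, neg_apply, submatrix_apply]

/-- Every aligned diagonal block of order `2 ^ m` of `Cmat (m + d)` is `Cmat m` up to sign. -/
theorem Cmat_submatrix_eq_or_eq_neg (m d p : ℕ) (hp : p < 2 ^ d)
    (e : Fin (2 ^ m) → Fin (2 ^ (m + d))) (he : ∀ t, (e t : ℕ) = p * 2 ^ m + t) :
    (Cmat (m + d)).submatrix e e = Cmat m ∨ (Cmat (m + d)).submatrix e e = -Cmat m := by
  induction d generalizing p with
  | zero =>
    obtain rfl : p = 0 := by simpa using hp
    obtain rfl : e = id := by
      funext t
      ext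
      simpa using he t
    exact Or.inl (submatrix_id_id _)
  | succ d ih =>
    have hlt : ∀ r : ℕ, r < 2 ^ d → ∀ t : Fin (2 ^ m), r * 2 ^ m + t < 2 ^ (m + d) := by
      intro r hr t
      calc r * 2 ^ m + t < (r + 1) * 2 ^ m := by rw [add_one_mul]; have := t.isLt; lia
        _ ≤ 2 ^ d * 2 ^ m := Nat.mul_le_mul_right _ hr
        _ = 2 ^ (m + d) := by ring
    rcases lt_or_ge p (2 ^ d) with hpd | hpd
    · have hsub := Cmat_succ_submatrix_left (m + d) (fun t => ⟨_, hlt p hpd t⟩) e he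
      exact hsub ▸ ih p hpd _ fun _ => rfl
    · obtain ⟨r, rfl⟩ := Nat.exists_eq_add_of_le hpd
      have hr : r < 2 ^ d := by rw [pow_succ] at hp; lia
      have hsub := Cmat_succ_submatrix_right (m + d) (fun t => ⟨_, hlt r hr t⟩) e
        fun t => by rw [he]; ring
      rcases ih r hr (fun t => ⟨_, hlt r hr t⟩) fun _ => rfl with h | h
      · exact Or.inr (hsub.trans (congrArg _ h))
      · exact Or.inl (hsub.trans (by rw [h, neg_neg]))

theorem stmt_6 (k : ℕ) (hk : 1 ≤ k) (d q : ℕ) (hd1 : 1 ≤ d) (hdk : d ≤ k - 1)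
    (hq1 : 1 ≤ q) (hq2 : q ≤ 2 ^ d)
    (e : Fin (2 ^ (k - d)) → Fin (2 ^ k))
    (he : ∀ t, (e t : ℕ) = (q - 1) * 2 ^ (k - d) + (t : ℕ)) :
    (Cmat k).submatrix e e = Cmat (k - d) ∨
    (Cmat k).submatrix e e = -(Cmat (k - d)) := by
  obtain ⟨m, rfl⟩ : ∃ m, k = m + d := ⟨k - d, by lia⟩
  have hm : m + d - d = m := Nat.add_sub_cancel m d
  generalize m + d - d = n at hm e he ⊢
  subst hm
  exact Cmat_submatrix_eq_or_eq_neg n d (q - 1) (by lia) e he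
end

section
/- Let k ≥ 1 be an integer, α = 1/√(2^k−1), and R(k) = I + i·α·C(k), where C(k) is the recursively defined skew-symmetric conference matrix of order 2^k. Then for every d ∈ {0,…,k} and every q ∈ {1,…,2^d}, the operator norm of the principal submatrix of R(k) whose rows and columns are indexed by S_{d,q} equals 1 + √(2^{k−d}−1)/√(2^k−1). -/
open Matrix

/-- `Rmat k = I + i·α·C(k)` viewed as a complex `2^k × 2^k` matrix,
where `α = 1/√(2^k - 1)`. -/
noncomputable def Rmat (k : ℕ) : Matrix (Fin (2 ^ k)) (Fin (2 ^ k)) ℂ :=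
  1 + (Complex.I * ((1 / Real.sqrt (2 ^ k - 1) : ℝ) : ℂ)) • (Cmat k).map (fun x => (x : ℂ))

/-- The operator norm of a complex matrix, induced by the Euclidean norm. -/
noncomputable def opNorm {ι : Type*} [Fintype ι] [DecidableEq ι] (M : Matrix ι ι ℂ) : ℝ :=
  ‖Matrix.toEuclideanCLM (𝕜 := ℂ) M‖

open scoped Matrix.Norms.L2Operator

theorem Cmat_transpose (k : ℕ) : (Cmat k)ᵀ = -Cmat k := by
  induction k with
  | zero => simp [Cmat]
  | succ k ih =>
    have h : (fromBlocks (Cmat k) (Cmat k - 1) (Cmat k + 1) (-(Cmat k)))ᵀ =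
        -fromBlocks (Cmat k) (Cmat k - 1) (Cmat k + 1) (-(Cmat k)) := by
      rw [fromBlocks_transpose, fromBlocks_neg]
      simp only [transpose_add, transpose_sub, transpose_neg, transpose_one, ih]
      congr 1 <;> abel
    simp only [Cmat, reindex_apply, transpose_submatrix, h]
    rfl

theorem Cmat_mul_self (k : ℕ) : Cmat k * Cmat k = (-(2 ^ k - 1) : ℝ) • 1 := by
  induction k with
  | zero => simp [Cmat]
  | succ k ih =>
    have h : fromBlocks (Cmat k) (Cmat k - 1) (Cmat k + 1) (-(Cmat k)) *
        fromBlocks (Cmat k) (Cmat k - 1) (Cmat k + 1) (-(Cmat k)) =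
        (-(2 ^ (k + 1) - 1) : ℝ) • 1 := by
      rw [fromBlocks_multiply, ← fromBlocks_one, fromBlocks_smul]
      simp only [mul_add, add_mul, mul_sub, sub_mul, mul_neg, neg_mul, mul_one, one_mul, ih]
      congr 1
      · module
      · module
      · module
      · module
    simp only [Cmat, reindex_apply, submatrix_mul_equiv, h, submatrix_smul, Pi.smul_apply, submatrix_one_equiv]

theorem Cmat_succ_apply_of_val_eq (k : ℕ) (i j : Fin (2 ^ (k + 1))) (i' j' : Fin (2 ^ k))
    (hi : (i : ℕ) = i') (hj : (j : ℕ) = j') : Cmat (k + 1) i j = Cmat k i' j' := by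
  let f : Fin (2 ^ k) ⊕ Fin (2 ^ k) ≃ Fin (2 ^ (k + 1)) :=
    finSumFinEquiv.trans (finCongr (by ring : 2 ^ k + 2 ^ k = 2 ^ (k + 1)))
  have h1 : f.symm i = Sum.inl i' := by
    rw [Equiv.symm_apply_eq]; ext; simp [f, hi]
  have h2 : f.symm j = Sum.inl j' := by
    rw [Equiv.symm_apply_eq]; ext; simp [f, hj]
  change fromBlocks _ _ _ _ (f.symm i) (f.symm j) = _
  rw [h1, h2, fromBlocks_apply₁₁]

theorem Cmat_succ_apply_of_val_eq_add (k : ℕ) (i j : Fin (2 ^ (k + 1))) (i' j' : Fin (2 ^ k))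
    (hi : (i : ℕ) = 2 ^ k + i') (hj : (j : ℕ) = 2 ^ k + j') :
    Cmat (k + 1) i j = -Cmat k i' j' := by
  let f : Fin (2 ^ k) ⊕ Fin (2 ^ k) ≃ Fin (2 ^ (k + 1)) :=
    finSumFinEquiv.trans (finCongr (by ring : 2 ^ k + 2 ^ k = 2 ^ (k + 1)))
  have h1 : f.symm i = Sum.inr i' := by
    rw [Equiv.symm_apply_eq]; ext; simp [f, hi, add_comm]
  have h2 : f.symm j = Sum.inr j' := by
    rw [Equiv.symm_apply_eq]; ext; simp [f, hj, add_comm]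
  change fromBlocks _ _ _ _ (f.symm i) (f.symm j) = _
  rw [h1, h2, fromBlocks_apply₂₂, neg_apply]

/-- The aligned diagonal blocks of `Cmat` are, up to sign, smaller matrices `Cmat`. -/
theorem exists_Cmat_submatrix_eq_smul (m d q : ℕ) (hq : q < 2 ^ d)
    (e : Fin (2 ^ m) → Fin (2 ^ (m + d))) (he : ∀ t, (e t : ℕ) = q * 2 ^ m + t) :
    ∃ s : ℝ, s * s = 1 ∧ (Cmat (m + d)).submatrix e e = s • Cmat m := by
  induction d generalizing q with
  | zero =>
    obtain rfl : q = 0 := by simpa using hq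
    refine ⟨1, one_mul 1, ?_⟩
    have : e = id := by
      funext t; ext; simp [he]
    rw [this, one_smul]
    rfl
  | succ d ih =>
    have key (r : ℕ) (hr : r < 2 ^ d) (t : Fin (2 ^ m)) : r * 2 ^ m + t < 2 ^ (m + d) := by
      calc r * 2 ^ m + t < r * 2 ^ m + 2 ^ m := by have := t.2; omega
        _ = (r + 1) * 2 ^ m := by ring
        _ ≤ 2 ^ d * 2 ^ m := Nat.mul_le_mul_right _ hr
        _ = 2 ^ (m + d) := by ring
    rcases lt_or_ge q (2 ^ d) with h | h
    · obtain ⟨s, hs, hC⟩ := ih q h (fun t => ⟨q * 2 ^ m + t, key q h t⟩) fun t => rfl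
      refine ⟨s, hs, ?_⟩
      rw [← hC]
      ext i j
      exact Cmat_succ_apply_of_val_eq (m + d) _ _ _ _ (he i) (he j)
    · obtain ⟨r, rfl⟩ := Nat.exists_eq_add_of_le h
      have hr : r < 2 ^ d := by rw [pow_succ] at hq; omega
      obtain ⟨s, hs, hC⟩ := ih r hr (fun t => ⟨r * 2 ^ m + t, key r hr t⟩) fun t => rfl
      refine ⟨-s, by rw [neg_mul_neg, hs], ?_⟩
      rw [neg_smul, ← hC]
      ext i j
      refine Cmat_succ_apply_of_val_eq_add (m + d) _ _ _ _ ?_ ?_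
      · rw [he]; dsimp only; ring
      · rw [he]; dsimp only; ring

/-- If `H` is Hermitian with `H ^ 2 = c ^ 2` and a vanishing diagonal entry, then
`1 + H` has operator norm `1 + c`. -/
theorem l2_opNorm_one_add_of_mul_self {ι : Type*} [Fintype ι] [DecidableEq ι]
    (H : Matrix ι ι ℂ) (hH : H.IsHermitian) (c : ℝ) (hc : 0 ≤ c)
    (hsq : H * H = ((c : ℂ) * c) • 1) (a : ι) (ha : H a a = 0) : ‖1 + H‖ = 1 + c := by
  have : Nonempty ι := ⟨a⟩
  have hnorm : ‖H‖ = c := by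
    have h := CStarRing.norm_star_mul_self (x := H)
    rw [star_eq_conjTranspose, hH.eq, hsq, norm_smul, norm_one, mul_one, ← Complex.ofReal_mul,
      Complex.norm_real, Real.norm_of_nonneg (mul_nonneg hc hc)] at h
    exact ((mul_self_inj hc (norm_nonneg _)).1 h).symm
  rcases hc.eq_or_lt with rfl | hpos
  · rw [norm_eq_zero.1 hnorm, add_zero, add_zero, norm_one]
  refine le_antisymm ((norm_add_le _ _).trans_eq (by rw [norm_one, hnorm])) ?_
  have hA : H + (c : ℂ) • 1 ≠ 0 := fun h => by
    have := congrFun (congrFun h a) a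
    simp [ha, hpos.ne'] at this
  have hmul : (1 + H) * (H + (c : ℂ) • 1) = ((1 + c : ℝ) : ℂ) • (H + (c : ℂ) • 1) := by
    simp only [mul_add, add_mul, one_mul, mul_smul_comm, mul_one, hsq]
    push_cast
    module
  have h := norm_mul_le (1 + H) (H + (c : ℂ) • 1)
  rw [hmul, norm_smul, Complex.norm_real, Real.norm_of_nonneg (by positivity)] at h
  exact le_of_mul_le_mul_right h (norm_pos_iff.2 hA)

theorem stmt_7 (k : ℕ) (hk : 1 ≤ k) (d q : ℕ) (hdk : d ≤ k)
    (hq1 : 1 ≤ q) (hq2 : q ≤ 2 ^ d)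
    (e : Fin (2 ^ (k - d)) → Fin (2 ^ k))
    (he : ∀ t, (e t : ℕ) = (q - 1) * 2 ^ (k - d) + (t : ℕ)) :
    opNorm ((Rmat k).submatrix e e)
      = 1 + Real.sqrt (2 ^ (k - d) - 1) / Real.sqrt (2 ^ k - 1) := by
  obtain ⟨m, rfl⟩ := Nat.exists_eq_add_of_le' hdk
  generalize hm : m + d - d = n at *
  obtain rfl : m = n := by omega
  obtain ⟨s, hs, hC⟩ := exists_Cmat_submatrix_eq_smul m d (q - 1) (by omega) e he
  have hinj : Function.Injective e := fun i j hij => by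
    have := congrArg Fin.val hij
    rw [he, he] at this
    exact Fin.ext (by omega)
  set b : ℝ := 1 / Real.sqrt (2 ^ (m + d) - 1) * s with hb
  set H : Matrix (Fin (2 ^ m)) (Fin (2 ^ m)) ℂ :=
    (Complex.I * b) • (Cmat m).map (fun x => (x : ℂ)) with hHdef
  have hR : (Rmat (m + d)).submatrix e e = 1 + H := by
    ext i j
    have hij : Cmat (m + d) (e i) (e j) = s * Cmat m i j := congrFun (congrFun hC i) j
    simp only [Rmat, hHdef, hb, submatrix_apply, Matrix.add_apply, Matrix.smul_apply,
      map_apply, hij, one_apply, hinj.eq_iff, smul_eq_mul]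
    push_cast
    ring
  have hskew (i j : Fin (2 ^ m)) : Cmat m j i = -Cmat m i j :=
    congrFun (congrFun (Cmat_transpose m) i) j
  have hH : H.IsHermitian := by
    ext i j
    simp [hHdef, hskew i j]
  have hone : (1 : ℝ) ≤ 2 ^ m := one_le_pow₀ one_le_two
  have hsq : H * H = (((Real.sqrt (2 ^ m - 1) / Real.sqrt (2 ^ (m + d) - 1) : ℝ) : ℂ) *
      (Real.sqrt (2 ^ m - 1) / Real.sqrt (2 ^ (m + d) - 1) : ℝ)) • 1 := by
    have hmap : (Cmat m).map (fun x => (x : ℂ)) * (Cmat m).map (fun x => (x : ℂ)) =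
        ((-(2 ^ m - 1) : ℝ) : ℂ) • 1 := by
      have h := congrArg (fun M => M.map Complex.ofRealHom) (Cmat_mul_self m)
      rw [Matrix.map_mul] at h
      refine h.trans ?_
      ext i j
      by_cases hij : i = j <;> simp [hij]
    rw [hHdef, smul_mul_smul_comm, hmap, smul_smul]
    congr 1
    have hbb : -(b * b) * -(2 ^ m - 1) = Real.sqrt (2 ^ m - 1) / Real.sqrt (2 ^ (m + d) - 1) *
        (Real.sqrt (2 ^ m - 1) / Real.sqrt (2 ^ (m + d) - 1)) := by
      rw [div_mul_div_comm, Real.mul_self_sqrt (sub_nonneg.2 hone), hb, mul_mul_mul_comm, hs]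
      ring
    rw [← Complex.ofReal_mul, ← hbb, mul_mul_mul_comm, Complex.I_mul_I]
    push_cast
    ring
  have hdiag : H 0 0 = 0 := by
    have : Cmat m 0 0 = 0 := self_eq_neg.1 (hskew 0 0)
    simp [hHdef, this]
  rw [hR]
  exact l2_opNorm_one_add_of_mul_self H hH _ (by positivity) hsq 0 hdiag
end

section
/- Let k ≥ 1 and r be integers with 1 ≤ r ≤ 2^k, and set d = ⌊log₂ r⌋ and r' = 2^d. Then the collection consisting of the sets S_{d+1,i} = {(i−1)·2^{k−(d+1)}+1, …, i·2^{k−(d+1)}} for i = 1, …, 2(r−r'), together with the sets S_{d,i} = {(i−1)·2^{k−d}+1, …, i·2^{k−d}} for i = r−r'+1, …, r', consists of exactly r pairwise disjoint nonempty subsets of {1,…,2^k} whose union is all of {1,…,2^k}, and each of these subsets has cardinality at most 2^{k−⌊log₂ r⌋}. -/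
open Matrix

/-- The diagonal index set `S_{d,q} = {(q-1)·2^(k-d)+1, …, q·2^(k-d)}` (1-based),
realized as a subset of `Fin (2^k)` (0-based). -/
def diagSet (k d q : ℕ) : Finset (Fin (2 ^ k)) :=
  Finset.univ.filter (fun j => (q - 1) * 2 ^ (k - d) ≤ (j : ℕ) ∧ (j : ℕ) < q * 2 ^ (k - d))

theorem exists_mem_Ico_succ_of_lt {a : ℕ → ℕ} (h0 : a 0 = 0) {r j : ℕ} (hj : j < a r) :
    ∃ h < r, a h ≤ j ∧ j < a (h + 1) := by
  induction r with
  | zero => omega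
  | succ r ih =>
    by_cases hjr : j < a r
    · obtain ⟨h, hr, hh⟩ := ih hjr
      exact ⟨h, by omega, hh⟩
    · exact ⟨r, by omega, by omega, hj⟩

/-- The consecutive intervals `[a h, a (h + 1))` cut out by a strictly increasing sequence running
from `0` to `n` partition `Fin n` into nonempty sets, each no larger than the largest gap. -/
theorem partition_of_strictMono {n r N : ℕ} {a : ℕ → ℕ} (ha : StrictMono a) (h0 : a 0 = 0)
    (hr : a r = n) (hN : ∀ h, a (h + 1) ≤ a h + N) {F : Fin r → Finset (Fin n)}
    (hF : ∀ h j, j ∈ F h ↔ a h ≤ (j : ℕ) ∧ (j : ℕ) < a (h + 1)) :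
    (∀ h h', h ≠ h' → Disjoint (F h) (F h')) ∧
    (∀ h, (F h).Nonempty) ∧
    Finset.univ.biUnion F = Finset.univ ∧
    (∀ h, (F h).card ≤ N) := by
  refine ⟨fun h h' hne => ?_, fun h => ?_, ?_, fun h => ?_⟩
  · rw [Finset.disjoint_left]
    intro j hj hj'
    rw [hF] at hj hj'
    have h₁ := ha.lt_iff_lt.mp (hj.1.trans_lt hj'.2)
    have h₂ := ha.lt_iff_lt.mp (hj'.1.trans_lt hj.2)
    exact hne (Fin.ext (by omega))
  · exact ⟨⟨a h, hr ▸ ha h.isLt⟩, (hF _ _).2 ⟨le_rfl, ha (Nat.lt_succ_self _)⟩⟩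
  · ext j
    obtain ⟨h, hh, hj⟩ := exists_mem_Ico_succ_of_lt h0 (hr.symm ▸ j.isLt : (j : ℕ) < a r)
    simpa using ⟨⟨h, hh⟩, (hF _ _).2 hj⟩
  · calc (F h).card = ((F h).map Fin.valEmbedding).card := (Finset.card_map _).symm
      _ ≤ (Finset.Ico (a h) (a (h + 1))).card := by
        refine Finset.card_le_card fun x hx => ?_
        obtain ⟨j, hj, rfl⟩ := Finset.mem_map.mp hx
        exact Finset.mem_Ico.mpr ((hF h j).1 hj)
      _ ≤ N := by
        have := hN h
        rw [Nat.card_Ico]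
        omega

theorem stmt_14 (k r : ℕ) (hk : 1 ≤ k) (hr1 : 1 ≤ r) (hr2 : r ≤ 2 ^ k)
    (d : ℕ) (hd : d = Nat.log 2 r) (r' : ℕ) (hr' : r' = 2 ^ d)
    (F : Fin r → Finset (Fin (2 ^ k)))
    (hF : ∀ h : Fin r, F h =
      if (h : ℕ) < 2 * (r - r') then diagSet k (d + 1) ((h : ℕ) + 1)
      else diagSet k d ((h : ℕ) - (r - r') + 1)) :
    (∀ h h', h ≠ h' → Disjoint (F h) (F h')) ∧
    (∀ h, (F h).Nonempty) ∧
    Finset.univ.biUnion F = Finset.univ ∧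
    (∀ h, (F h).card ≤ 2 ^ (k - Nat.log 2 r)) := by
  have hle : r' ≤ r := by
    rw [hr', hd]
    exact Nat.pow_log_le_self 2 (by omega)
  have hdk : d ≤ k := by
    rw [hd]
    exact (Nat.log_mono_right hr2).trans_eq (Nat.log_pow one_lt_two k)
  obtain ⟨s, rfl⟩ := Nat.exists_eq_add_of_le hle
  simp only [Nat.add_sub_cancel_left] at hF
  have hs : s < r' := by
    have := Nat.lt_pow_succ_log_self one_lt_two (r' + s)
    rw [← hd, pow_succ, ← hr'] at this
    omega
  rw [← hd]
  have hN : r' * 2 ^ (k - d) = 2 ^ k := by rw [hr', ← pow_add, Nat.add_sub_cancel' hdk]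
  have hM : s * 2 ^ (k - d) = 2 * s * 2 ^ (k - (d + 1)) := by
    rcases hdk.eq_or_lt with rfl | hlt
    · have : s = 0 := by omega
      simp [this]
    · rw [show k - d = k - (d + 1) + 1 by omega, pow_succ]
      ring
  have hMN : 2 ^ (k - (d + 1)) ≤ 2 ^ (k - d) := Nat.pow_le_pow_right two_pos (by omega)
  have hMpos : 0 < 2 ^ (k - (d + 1)) := by positivity
  generalize hMdef : 2 ^ (k - (d + 1)) = M at *
  generalize hNdef : 2 ^ (k - d) = N at *
  set a : ℕ → ℕ := fun h => min h (2 * s) * M + (h - 2 * s) * N with ha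
  have hlow : ∀ h ≤ 2 * s, a h = h * M := fun h hh => by
    simp [ha, min_eq_left hh, Nat.sub_eq_zero_of_le hh]
  have hhigh : ∀ h, 2 * s ≤ h → a h = (h - s) * N := fun h hh => by
    obtain ⟨t, rfl⟩ := Nat.exists_eq_add_of_le hh
    simp only [ha, min_eq_right hh, Nat.add_sub_cancel_left, ← hM]
    rw [show 2 * s + t - s = s + t by omega, add_mul]
  have hstep : ∀ h, a (h + 1) = a h + if h < 2 * s then M else N := fun h => by
    split_ifs with hh
    · rw [hlow (h + 1) hh, hlow h hh.le, add_one_mul]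
    · rw [hhigh h (by omega), hhigh (h + 1) (by omega), Nat.sub_add_comm (by omega), add_one_mul]
  refine partition_of_strictMono (a := a) (strictMono_nat_of_lt_succ fun h => ?_) (by simp [ha]) ?_
    (fun h => ?_) fun h j => ?_
  · rw [hstep]
    split_ifs <;> omega
  · rw [hhigh _ (by omega), Nat.add_sub_cancel, hN]
  · rw [hstep]
    split_ifs <;> omega
  · rw [hF]
    split_ifs with hh
    · simp [diagSet, hMdef, hlow h hh.le, hlow (h + 1) hh]
    · rw [hhigh h (by omega), hhigh (h + 1) (by omega), Nat.sub_add_comm (by omega)]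
      simp [diagSet, hNdef]
end
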